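/- Let q/(q+1) < p < ∞, 1 < q < ∞, and r = pq/(pq+p−q). Then for all x ∈ [0, π_{r,q}/2), sinh_{p,q}(x) = sin_{r,q}(x) / (cos_{r,q}(x))^{r/q}. -/

import Mathlib

open MeasureTheory Set
open scoped ENNReal

/-- `genF p q y = ∫_0^y (1 - t^q)^(-1/p) dt`, whose inverse is the generalized sine. -/
noncomputable def genF (p q y : ℝ) : ℝ := ∫ t in (0:ℝ)..y, (1 - t ^ q) ^ (-(1 / p))

/-- `genG p q y = ∫_0^y (1 + t^q)^(-1/p) dt`, whose inverse is the generalized hyperbolic sine. -/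
noncomputable def genG (p q y : ℝ) : ℝ := ∫ t in (0:ℝ)..y, (1 + t ^ q) ^ (-(1 / p))

/-- The generalized π, `π_{p,q} = 2∫_0^1 (1 - t^q)^(-1/p) dt`, as an extended real number
(it is `∞` when `q/(q+1) < p ≤ 1`). -/
noncomputable def genPi (p q : ℝ) : ℝ≥0∞ :=
  2 * ∫⁻ t in Ioo (0:ℝ) 1, ENNReal.ofReal ((1 - t ^ q) ^ (-(1 / p)))

/-- The generalized sine `sin_{p,q}`: the inverse of `genF p q`, which maps `[0,1)` onto
`[0, π_{p,q}/2)`. -/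
noncomputable def gsin (p q : ℝ) : ℝ → ℝ := Function.invFunOn (genF p q) (Ico 0 1)

/-- The generalized cosine `cos_{p,q} x = (d/dx) sin_{p,q} x` (one-sided at `x = 0`). -/
noncomputable def gcos (p q x : ℝ) : ℝ := derivWithin (gsin p q) (Ici 0) x

/-- The generalized hyperbolic sine `sinh_{p,q}`: the inverse of `genG p q`, which maps
`[0,∞)` onto `[0, π_{r,q}/2)` where `r = pq/(pq+p-q)`. -/
noncomputable def gsinh (p q : ℝ) : ℝ → ℝ := Function.invFunOn (genG p q) (Ici 0)

/-- The generalized hyperbolic cosine `cosh_{p,q} x = (d/dx) sinh_{p,q} x`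
(one-sided at `x = 0`). -/
noncomputable def gcosh (p q x : ℝ) : ℝ := derivWithin (gsinh p q) (Ici 0) x

open Filter Topology

theorem one_sub_rpow_pos {q y : ℝ} (hq : 0 < q) (hy : y ∈ Ico (0 : ℝ) 1) : 0 < 1 - y ^ q :=
  sub_pos.2 (Real.rpow_lt_one hy.1 hy.2 hq)

theorem continuousAt_genF_integrand {q y : ℝ} (p : ℝ) (hq : 0 < q) (hy : y ∈ Ico (0 : ℝ) 1) :
    ContinuousAt (fun t : ℝ => (1 - t ^ q) ^ (-(1 / p))) y :=
  (continuousAt_const.sub (Real.continuousAt_rpow_const y q (Or.inr hq.le))).rpow_const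
    (Or.inl (one_sub_rpow_pos hq hy).ne')

theorem intervalIntegrable_genF_integrand {q y : ℝ} (p : ℝ) (hq : 0 < q)
    (hy : y ∈ Ico (0 : ℝ) 1) :
    IntervalIntegrable (fun t : ℝ => (1 - t ^ q) ^ (-(1 / p))) volume 0 y := by
  refine ContinuousOn.intervalIntegrable fun t ht => ?_
  rw [uIcc_of_le hy.1] at ht
  exact (continuousAt_genF_integrand p hq ⟨ht.1, ht.2.trans_lt hy.2⟩).continuousWithinAt

theorem hasDerivAt_genF {q y : ℝ} (p : ℝ) (hq : 0 < q) (hy : y ∈ Ico (0 : ℝ) 1) :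
    HasDerivAt (genF p q) ((1 - y ^ q) ^ (-(1 / p))) y := by
  refine intervalIntegral.integral_hasDerivAt_right (intervalIntegrable_genF_integrand p hq hy)
    ?_ (continuousAt_genF_integrand p hq hy)
  exact (by fun_prop : Measurable fun t : ℝ => (1 - t ^ q) ^ (-(1 / p))).stronglyMeasurable
    |>.stronglyMeasurableAtFilter

theorem one_add_rpow_pos {q u : ℝ} (hu : 0 ≤ u) : 0 < 1 + u ^ q := by positivity

theorem continuousAt_genG_integrand {q u : ℝ} (p : ℝ) (hq : 0 < q) (hu : 0 ≤ u) :
    ContinuousAt (fun t : ℝ => (1 + t ^ q) ^ (-(1 / p))) u :=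
  (continuousAt_const.add (Real.continuousAt_rpow_const u q (Or.inr hq.le))).rpow_const
    (Or.inl (one_add_rpow_pos hu).ne')

theorem hasDerivAt_genG {q u : ℝ} (p : ℝ) (hq : 0 < q) (hu : 0 ≤ u) :
    HasDerivAt (genG p q) ((1 + u ^ q) ^ (-(1 / p))) u := by
  refine intervalIntegral.integral_hasDerivAt_right ?_ ?_ (continuousAt_genG_integrand p hq hu)
  · refine ContinuousOn.intervalIntegrable fun t ht => ?_
    rw [uIcc_of_le hu] at ht
    exact (continuousAt_genG_integrand p hq ht.1).continuousWithinAt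
  · exact (by fun_prop : Measurable fun t : ℝ => (1 + t ^ q) ^ (-(1 / p))).stronglyMeasurable
      |>.stronglyMeasurableAtFilter

theorem strictMonoOn_genG {q : ℝ} (p : ℝ) (hq : 0 < q) : StrictMonoOn (genG p q) (Ici 0) := by
  refine strictMonoOn_of_deriv_pos (convex_Ici 0)
    (fun u hu => (hasDerivAt_genG p hq hu).continuousAt.continuousWithinAt) fun u hu => ?_
  rw [interior_Ici, mem_Ioi] at hu
  rw [(hasDerivAt_genG p hq hu.le).deriv]
  exact Real.rpow_pos_of_pos (one_add_rpow_pos hu.le) _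

/-- The integrand of `genF` is at least `1`, so `genF` is expanding on `[0,1)`. -/
theorem sub_le_genF_sub {p q : ℝ} (hp : 0 < p) (hq : 0 < q) {a b : ℝ} (ha : a ∈ Ico (0 : ℝ) 1)
    (hb : b ∈ Ico (0 : ℝ) 1) (hab : a ≤ b) : b - a ≤ genF p q b - genF p q a := by
  have key := (convex_Ico (0 : ℝ) 1).mul_sub_le_image_sub_of_le_deriv (f := genF p q) (C := 1)
    (fun y hy => (hasDerivAt_genF p hq hy).continuousAt.continuousWithinAt)
    (fun y hy => (hasDerivAt_genF p hq (interior_subset hy)).differentiableAt.differentiableWithinAt)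
    (fun y hy => by
      have hy' := interior_subset hy
      rw [(hasDerivAt_genF p hq hy').deriv]
      refine Real.one_le_rpow_of_pos_of_le_one_of_nonpos (one_sub_rpow_pos hq hy') ?_ ?_
      · linarith [Real.rpow_nonneg hy'.1 q]
      · exact neg_nonpos.2 (by positivity))
  simpa using key a ha b hb hab

theorem abs_sub_le_abs_genF_sub {p q : ℝ} (hp : 0 < p) (hq : 0 < q) {a b : ℝ}
    (ha : a ∈ Ico (0 : ℝ) 1) (hb : b ∈ Ico (0 : ℝ) 1) :
    |a - b| ≤ |genF p q a - genF p q b| := by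
  rcases le_total a b with h | h
  · rw [abs_sub_comm, abs_sub_comm (genF p q a), abs_of_nonneg (sub_nonneg.2 h)]
    exact (sub_le_genF_sub hp hq ha hb h).trans (le_abs_self _)
  · rw [abs_of_nonneg (sub_nonneg.2 h)]
    exact (sub_le_genF_sub hp hq hb ha h).trans (le_abs_self _)

theorem injOn_genF {p q : ℝ} (hp : 0 < p) (hq : 0 < q) : InjOn (genF p q) (Ico 0 1) := by
  intro a ha b hb h
  have := abs_sub_le_abs_genF_sub hp hq ha hb
  rw [h, sub_self, abs_zero] at this
  exact sub_eq_zero.1 (abs_nonpos_iff.1 this)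

theorem genF_zero (p q : ℝ) : genF p q 0 = 0 := intervalIntegral.integral_same

theorem Ico_subset_image_genF {q b : ℝ} (p : ℝ) (hq : 0 < q) (hb : b ∈ Ico (0 : ℝ) 1) :
    Ico 0 (genF p q b) ⊆ genF p q '' Ico 0 1 := by
  intro x hx
  have := intermediate_value_Icc hb.1 (f := genF p q) fun y hy =>
    (hasDerivAt_genF p hq ⟨hy.1, hy.2.trans_lt hb.2⟩).continuousAt.continuousWithinAt
  rw [genF_zero] at this
  obtain ⟨y, hy, rfl⟩ := this (Ico_subset_Icc_self hx)
  exact ⟨y, ⟨hy.1, hy.2.trans_lt hb.2⟩, rfl⟩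

theorem ofReal_genF {q b : ℝ} (p : ℝ) (hq : 0 < q) (hb : b ∈ Ico (0 : ℝ) 1) :
    ENNReal.ofReal (genF p q b) =
      ∫⁻ t in Ioc (0 : ℝ) b, ENNReal.ofReal ((1 - t ^ q) ^ (-(1 / p))) := by
  rw [genF, intervalIntegral.integral_of_le hb.1]
  refine ofReal_integral_eq_lintegral_ofReal
    ((intervalIntegrable_iff_integrableOn_Ioc_of_le hb.1).1
      (intervalIntegrable_genF_integrand p hq hb)) ?_
  filter_upwards [ae_restrict_mem measurableSet_Ioc] with t ht
  exact Real.rpow_nonneg (one_sub_rpow_pos hq ⟨ht.1.le, ht.2.trans_lt hb.2⟩).le _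

/-- `genPi p q / 2` is the supremum of `genF p q` on `[0,1)`. -/
theorem exists_lt_genF_of_lt_genPi {p q x : ℝ} (hq : 0 < q)
    (hx : ENNReal.ofReal x < genPi p q / 2) : ∃ b ∈ Ico (0 : ℝ) 1, x < genF p q b := by
  obtain ⟨v, hv_mono, hv, hv_lim⟩ := exists_seq_strictMono_tendsto' (zero_lt_one' ℝ)
  have hU : Ioo (0 : ℝ) 1 = ⋃ n, Ioc 0 (v n) := by
    ext t
    simp only [mem_iUnion]
    constructor
    · intro ht
      obtain ⟨n, hn⟩ := (hv_lim.eventually (lt_mem_nhds ht.2)).exists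
      exact ⟨n, ht.1, hn.le⟩
    · rintro ⟨n, hn⟩
      exact ⟨hn.1, hn.2.trans_lt (hv n).2⟩
  have hmono : Monotone fun n => Ioc (0 : ℝ) (v n) := fun m n h =>
    Ioc_subset_Ioc_right (hv_mono.monotone h)
  rw [genPi, mul_comm, ENNReal.mul_div_cancel_right two_ne_zero ENNReal.ofNat_ne_top,
    ← withDensity_apply _ measurableSet_Ioo, hU, hmono.measure_iUnion] at hx
  obtain ⟨n, hn⟩ := lt_iSup_iff.1 hx
  have hvn : v n ∈ Ico (0 : ℝ) 1 := ⟨(hv n).1.le, (hv n).2⟩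
  rw [withDensity_apply _ measurableSet_Ioc, ← ofReal_genF p hq hvn] at hn
  exact ⟨v n, hvn, (ENNReal.ofReal_lt_ofReal_iff'.1 hn).1⟩

theorem gsin_genF {p q y : ℝ} (hp : 0 < p) (hq : 0 < q) (hy : y ∈ Ico (0 : ℝ) 1) :
    gsin p q (genF p q y) = y :=
  (injOn_genF hp hq).leftInvOn_invFunOn hy

theorem gsinh_genG {p q u : ℝ} (hq : 0 < q) (hu : 0 ≤ u) : gsinh p q (genG p q u) = u :=
  (strictMonoOn_genG p hq).injOn.leftInvOn_invFunOn hu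

theorem gcos_genF {p q y b : ℝ} (hp : 0 < p) (hq : 0 < q) (hy : y ∈ Ico (0 : ℝ) 1)
    (hb : b ∈ Ico (0 : ℝ) 1) (hyb : genF p q y < genF p q b) :
    gcos p q (genF p q y) = (1 - y ^ q) ^ (1 / p) := by
  have hpos := one_sub_rpow_pos hq hy
  have hx0 : 0 ≤ genF p q y := by
    have := sub_le_genF_sub hp hq ⟨le_rfl, zero_lt_one⟩ hy hy.1
    rw [genF_zero] at this
    linarith [hy.1]
  have hev : ∀ᶠ x in 𝓝[Ici 0] genF p q y, ∃ z ∈ Ico (0 : ℝ) 1, genF p q z = x := by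
    filter_upwards [self_mem_nhdsWithin, mem_nhdsWithin_of_mem_nhds (Iio_mem_nhds hyb)]
      with x h0 h1
    exact Ico_subset_image_genF p hq hb ⟨h0, h1⟩
  have hinv : ∀ᶠ x in 𝓝[Ici 0] genF p q y, genF p q (gsin p q x) = x := by
    filter_upwards [hev] with x ⟨z, hz, hzx⟩
    rw [← hzx, gsin_genF hp hq hz]
  have htend : Tendsto (gsin p q) (𝓝[Ici 0] genF p q y) (𝓝 y) := by
    rw [tendsto_iff_dist_tendsto_zero]
    have hid : Tendsto (fun x => dist x (genF p q y)) (𝓝[Ici 0] genF p q y) (𝓝 0) :=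
      tendsto_iff_dist_tendsto_zero.1 (tendsto_id.mono_left nhdsWithin_le_nhds)
    refine squeeze_zero' (Eventually.of_forall fun _ => dist_nonneg) ?_ hid
    filter_upwards [hev] with x ⟨z, hz, hzx⟩
    rw [← hzx, gsin_genF hp hq hz, Real.dist_eq, Real.dist_eq]
    exact abs_sub_le_abs_genF_sub hp hq hz hy
  have hd : HasDerivAt (genF p q) ((1 - y ^ q) ^ (-(1 / p))) (gsin p q (genF p q y)) := by
    rw [gsin_genF hp hq hy]
    exact hasDerivAt_genF p hq hy
  have hne : (1 - y ^ q) ^ (-(1 / p)) ≠ 0 := (Real.rpow_pos_of_pos hpos _).ne'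
  have hg := ((hd.hasFDerivAt_equiv hne).hasFDerivWithinAt (s := univ)).of_local_left_inverse
    (by rwa [nhdsWithin_univ, gsin_genF hp hq hy]) (mem_Ici.2 hx0) hinv
  have hg' : HasDerivWithinAt (gsin p q) ((1 - y ^ q) ^ (-(1 / p)))⁻¹ (Ici 0) (genF p q y) := hg
  rw [gcos, hg'.derivWithin (uniqueDiffOn_Ici 0 _ hx0), Real.rpow_neg hpos.le, inv_inv]

theorem hasDerivAt_div_one_sub_rpow {q y : ℝ} (hq : 1 < q) (hy : y ∈ Ico (0 : ℝ) 1) :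
    HasDerivAt (fun t : ℝ => t / (1 - t ^ q) ^ (1 / q)) ((1 - y ^ q) ^ (-(1 / q) - 1)) y := by
  have hq0 : 0 < q := by linarith
  have hpos := one_sub_rpow_pos hq0 hy
  have h1 : HasDerivAt (fun t : ℝ => 1 - t ^ q) (-(q * y ^ (q - 1))) y :=
    (Real.hasDerivAt_rpow_const (Or.inr hq.le)).const_sub 1
  have h2 := (hasDerivAt_id y).mul (h1.rpow_const (p := -(1 / q)) (Or.inl hpos.ne'))
  have hyq : y ^ q = y * y ^ (q - 1) := by
    rcases hy.1.eq_or_lt with h | h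
    · simp [← h, hq0.ne']
    · rw [← Real.rpow_one_add' h.le (by linarith)]
      congr 1
      ring
  have hsplit : (1 - y ^ q) ^ (-(1 / q)) = (1 - y ^ q) ^ (-(1 / q) - 1) * (1 - y ^ q) := by
    rw [Real.rpow_sub_one hpos.ne', div_mul_cancel₀ _ hpos.ne']
  refine (h2.congr_deriv ?_).congr_of_eventuallyEq ?_
  · rw [hsplit, id]
    generalize (1 - y ^ q) ^ (-(1 / q) - 1) = c
    rw [hyq]
    field_simp
    ring
  · filter_upwards [h1.continuousAt.eventually (lt_mem_nhds hpos)] with t ht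
    simp only [Pi.mul_apply, id]
    rw [Real.rpow_neg (le_of_lt ht), div_eq_mul_inv]

theorem one_add_div_one_sub_rpow {q y : ℝ} (hq : 0 < q) (hy : y ∈ Ico (0 : ℝ) 1) :
    1 + (y / (1 - y ^ q) ^ (1 / q)) ^ q = (1 - y ^ q)⁻¹ := by
  have hpos := one_sub_rpow_pos hq hy
  rw [Real.div_rpow hy.1 (Real.rpow_nonneg hpos.le _), ← Real.rpow_mul hpos.le,
    one_div_mul_cancel hq.ne', Real.rpow_one]
  field_simp
  ring

theorem genG_div_one_sub_rpow {p q r y : ℝ} (hq : 1 < q) (hr : 1 / r = 1 + 1 / q - 1 / p)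
    (hy : y ∈ Ico (0 : ℝ) 1) : genG p q (y / (1 - y ^ q) ^ (1 / q)) = genF r q y := by
  have hq0 : 0 < q := by linarith
  have hd : ∀ t ∈ Icc 0 y,
      HasDerivAt (fun t => genG p q (t / (1 - t ^ q) ^ (1 / q)) - genF r q t) 0 t := by
    intro t ht
    have ht' : t ∈ Ico (0 : ℝ) 1 := ⟨ht.1, ht.2.trans_lt hy.2⟩
    have hpos := one_sub_rpow_pos hq0 ht'
    have hG := (hasDerivAt_genG p hq0 (div_nonneg ht.1 (Real.rpow_nonneg hpos.le _))).comp t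
      (hasDerivAt_div_one_sub_rpow hq ht')
    refine (hG.sub (hasDerivAt_genF r hq0 ht')).congr_deriv ?_
    rw [one_add_div_one_sub_rpow hq0 ht', Real.inv_rpow hpos.le, ← Real.rpow_neg hpos.le,
      ← Real.rpow_add hpos, hr, sub_eq_zero]
    congr 1
    ring
  have := constant_of_has_deriv_right_zero
    (fun t ht => (hd t ht).continuousAt.continuousWithinAt)
    (fun t ht => (hd t (Ico_subset_Icc_self ht)).hasDerivWithinAt) y ⟨hy.1, le_rfl⟩
  simpa [genF_zero, genG, sub_eq_zero] using this

/-- for `q/(q+1) < p < ∞`, `1 < q < ∞`, `r = pq/(pq+p-q)` and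
`x ∈ [0, π_{r,q}/2)`, `sinh_{p,q} x = sin_{r,q} x / (cos_{r,q} x)^(r/q)`. -/
theorem sinh_eq_sin_div_cos_rpow (p q r : ℝ) (hq : 1 < q) (hp : q / (q + 1) < p)
    (hr : r = p * q / (p * q + p - q)) (x : ℝ) (hx0 : 0 ≤ x)
    (hx : ENNReal.ofReal x < genPi r q / 2) :
    gsinh p q x = gsin r q x / gcos r q x ^ (r / q) := by
  have hq0 : 0 < q := by linarith
  have hp0 : 0 < p := lt_trans (by positivity) hp
  have hden : 0 < p * q + p - q := by
    rw [div_lt_iff₀ (by linarith)] at hp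
    linarith
  have hr0 : 0 < r := hr ▸ by positivity
  have hrinv : 1 / r = 1 + 1 / q - 1 / p := by
    rw [hr]
    field_simp
  obtain ⟨b, hb, hxb⟩ := exists_lt_genF_of_lt_genPi hq0 hx
  obtain ⟨y, hy, rfl⟩ := Ico_subset_image_genF r hq0 hb ⟨hx0, hxb⟩
  have hpos := one_sub_rpow_pos hq0 hy
  rw [gsin_genF hr0 hq0 hy, gcos_genF hr0 hq0 hy hb hxb, ← Real.rpow_mul hpos.le,
    ← genG_div_one_sub_rpow hq hrinv hy,
    gsinh_genG hq0 (div_nonneg hy.1 (Real.rpow_nonneg hpos.le _))]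
  congr 2
  field_simp
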